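/- Let A = (𝒜_1, …, 𝒜_k) be a collection of k finite nonempty subsets of ℤ^n, indexed by S = {1, …, k}, which is essential with negative defect, i.e., d(A) = def(S) < 0 and def(J) > d(A) for every proper subset J ⊊ S. Then there exists a polynomial function F on Ω_A that does not vanish identically on the set of consistency X_A, such that for every f ∈ X_A with F(f) ≠ 0, the zero set Y_f is nonempty and is a single coset of the subgroup ker(G(A)): for every x₀ ∈ Y_f one has Y_f = {x₀·t : t ∈ (ℂ*)^n, t^g = 1 for all g ∈ G(A)}. -/

import Mathlib

noncomputable section

/-- `L(J)`: the `ℝ`-linear span of all differences `a - b` with `a, b ∈ B i` for some `i ∈ J`. -/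
def colSpan {ι V : Type*} [AddCommGroup V] [Module ℝ V]
    (B : ι → Set V) (J : Set ι) : Submodule ℝ V :=
  Submodule.span ℝ {v | ∃ i ∈ J, ∃ a ∈ B i, ∃ b ∈ B i, v = a - b}

/-- The defect `def(J) = dim L(J) - |J|`. -/
def colDefect {ι V : Type*} [AddCommGroup V] [Module ℝ V]
    (B : ι → Set V) (J : Finset ι) : ℤ :=
  (Module.finrank ℝ (colSpan B (J : Set ι)) : ℤ) - (J.card : ℤ)

/-- The minimal defect `min_{J ⊆ S} def(J)` over all subsets of `S` (including `∅`). -/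
def colMinDefectOn {ι V : Type*} [AddCommGroup V] [Module ℝ V]
    (B : ι → Set V) (S : Finset ι) : ℤ :=
  S.powerset.inf' ⟨∅, Finset.empty_mem_powerset S⟩ (fun J => colDefect B J)

/-- A finite subset of `ℤ^n` viewed inside `ℝ^n`. -/
def realize {n : ℕ} (A : Finset (Fin n → ℤ)) : Set (Fin n → ℝ) :=
  (fun a : Fin n → ℤ => fun j => (a j : ℝ)) '' (A : Set (Fin n → ℤ))

/-- The monomial `p^a = ∏_j p_j^{a_j}` as an element of `ℂˣ`. -/
def mon {n : ℕ} (p : Fin n → ℂˣ) (a : Fin n → ℤ) : ℂˣ :=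
  ∏ j, p j ^ a j

/-- Evaluation of a Laurent polynomial `f` with support in `A` at `p ∈ (ℂ*)^n`:
`f(p) = ∑_{a ∈ A} f_a · p^a`. -/
def evalL {n : ℕ} {A : Finset (Fin n → ℤ)} (f : {x // x ∈ A} → ℂ) (p : Fin n → ℂˣ) : ℂ :=
  ∑ a : {x // x ∈ A}, f a * (mon p a.1 : ℂ)

/-- `t ∈ ker(G(A))`: every difference of two points of one of the supports takes value `1`
at `t`. -/
def inKer {n k : ℕ} (A : Fin k → Finset (Fin n → ℤ)) (t : Fin n → ℂˣ) : Prop :=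
  ∀ i, ∀ a ∈ A i, ∀ b ∈ A i, mon t (a - b) = 1

section RelAlgClosure

variable {K E : Type*} [Field K] [Field E] [Algebra K E]

/-- The algebraic closure inside `E` of the subfield generated over `K` by `Y`. -/
def relAlgClosure (K : Type*) {E : Type*} [Field K] [Field E] [Algebra K E] (Y : Set E) :
    IntermediateField K E :=
  ((Subalgebra.algebraicClosure (Algebra.adjoin K Y) E).restrictScalars K).toIntermediateField
    fun _ hx => IsAlgebraic.inv hx

theorem coe_relAlgClosure (Y : Set E) :
    (relAlgClosure K Y : Set E) = (AlgebraicIndependent.matroid K E).closure Y := by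
  rw [AlgebraicIndependent.matroid_closure_eq]
  rfl

theorem subset_relAlgClosure (Y : Set E) : Y ⊆ relAlgClosure K Y := fun x hx =>
  isAlgebraic_algebraMap (⟨x, Algebra.subset_adjoin hx⟩ : Algebra.adjoin K Y)

theorem mem_relAlgClosure_of_pow {Y : Set E} {x : E} {m : ℕ} (hm : 0 < m)
    (hx : x ^ m ∈ relAlgClosure K Y) : x ∈ relAlgClosure K Y :=
  IsAlgebraic.of_pow hm hx

theorem mem_relAlgClosure_of_isAlgebraic {Y : Set E} {M : IntermediateField K E}
    (hM : M ≤ relAlgClosure K Y) {x : E} (hx : IsAlgebraic M x) : x ∈ relAlgClosure K Y := by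
  have h := AlgebraicIndependent.matroid_closure_eq (R := K) (s := (relAlgClosure K Y : Set E))
  rw [coe_relAlgClosure, Matroid.closure_closure, ← coe_relAlgClosure] at h
  rw [← SetLike.mem_coe, h]
  change IsAlgebraic (Algebra.adjoin K _) x
  have hle : M.toSubalgebra ≤ Algebra.adjoin K (relAlgClosure K Y : Set E) :=
    fun y hy => Algebra.subset_adjoin (hM hy)
  let _ : Algebra M (Algebra.adjoin K (relAlgClosure K Y : Set E)) :=
    (Subalgebra.inclusion hle).toAlgebra
  have : IsScalarTower M (Algebra.adjoin K (relAlgClosure K Y : Set E)) E :=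
    IsScalarTower.of_algebraMap_eq fun _ => rfl
  exact hx.extendScalars (Subalgebra.inclusion_injective hle)

theorem relAlgClosure_le {Y Y' : Set E} (h : Y ⊆ relAlgClosure K Y') :
    relAlgClosure K Y ≤ relAlgClosure K Y' := by
  rw [← SetLike.coe_subset_coe, coe_relAlgClosure, coe_relAlgClosure]
  rw [coe_relAlgClosure] at h
  exact Matroid.closure_subset_closure_of_subset_closure h

theorem AlgebraicIndependent.card_le_of_mem_relAlgClosure {ι : Type*} [Fintype ι] {x : ι → E}
    (hx : AlgebraicIndependent K x) (Y : Finset E) (h : ∀ i, x i ∈ relAlgClosure K (Y : Set E)) :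
    Fintype.card ι ≤ Y.card := by
  have hI : (AlgebraicIndependent.matroid K E).Indep (Set.range x) :=
    AlgebraicIndependent.matroid_indep_iff.2 hx.coe_range
  have hsub : Set.range x ⊆ (AlgebraicIndependent.matroid K E).closure Y := by
    rw [← coe_relAlgClosure]
    rintro _ ⟨i, rfl⟩
    exact h i
  have := (hI.encard_le_eRk_of_subset hsub).trans
    ((Matroid.eRk_closure_eq _ _).le.trans (Matroid.eRk_le_encard _ _))
  rw [Set.encard_coe_eq_coe_finsetCard, ← Set.image_univ, hx.injective.encard_image,
    Set.encard_univ, ENat.card_eq_coe_fintype_card] at this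
  exact_mod_cast this

theorem exists_algebraicIndependent_finset {ι : Type*} [Fintype ι] (x : ι → E) :
    ∃ T : Finset ι, AlgebraicIndependent K (fun t : T => x t) ∧
      ∀ i, x i ∈ relAlgClosure K (x '' (T : Set ι)) := by
  classical
  obtain ⟨B, hB⟩ := (AlgebraicIndependent.matroid K E).exists_isBasis (Set.range x)
  have hBx : ∀ b : B, ∃ i, x i = b := fun b => hB.subset b.2
  choose s hs using hBx
  set T : Finset ι := (Set.toFinite (Set.range s)).toFinset with hTdef
  have hT : (T : Set ι) = Set.range s := by simp [hTdef]
  have hTs : ∀ t : T, ∃ b, s b = t := fun t => by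
    have : (t : ι) ∈ (T : Set ι) := t.2
    rwa [hT] at this
  choose b hb using hTs
  refine ⟨T, ?_, fun i => ?_⟩
  · have hxb : (fun t : T => x t) = fun t => ((b t : B) : E) := by
      funext t
      rw [← hb t, hs]
    rw [hxb]
    refine (AlgebraicIndependent.matroid_indep_iff.1 hB.indep).comp b fun t t' h => ?_
    rw [Subtype.ext_iff, ← hb t, ← hb t', h]
  · have hTB : x '' (Set.range s) = B := by
      rw [← Set.range_comp]
      ext y
      simp [hs]
    rw [hT, hTB, ← SetLike.mem_coe, coe_relAlgClosure, hB.closure_eq_closure]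
    exact Matroid.subset_closure _ _ (Set.subset_univ _) ⟨i, rfl⟩

end RelAlgClosure

section LatticeRank

variable {n : ℕ}

/-- The inclusion `ℤ^n → ℝ^n`. -/
def realVec (a : Fin n → ℤ) : Fin n → ℝ := fun j => (a j : ℝ)

/-- The dimension of the real span of a set of integer vectors. -/
def spanRank (D : Set (Fin n → ℤ)) : ℕ :=
  Module.finrank ℝ (Submodule.span ℝ (realVec '' D))

theorem exists_nsmul_mem_closure_of_realVec_mem_span (b : Finset (Fin n → ℤ)) (d : Fin n → ℤ)
    (hd : realVec d ∈ Submodule.span ℝ (realVec '' (b : Set (Fin n → ℤ)))) :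
    ∃ m : ℕ, 0 < m ∧ m • d ∈ AddSubgroup.closure (b : Set (Fin n → ℤ)) := by
  classical
  obtain ⟨c, hc⟩ : ∃ c : (Fin n → ℤ) → ℝ, ∑ v ∈ b, c v • realVec v = realVec d := by
    obtain ⟨c, hc⟩ := (Submodule.mem_span_image_finset_iff_exists_fun ℝ).1 hd
    refine ⟨fun v => if h : v ∈ b then c ⟨v, h⟩ else 0, ?_⟩
    rw [← hc, ← Finset.sum_coe_sort]
    simp
  obtain ⟨π, hπ⟩ := LinearMap.exists_leftInverse_of_injective (Algebra.linearMap ℚ ℝ)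
    (LinearMap.ker_eq_bot.2 (algebraMap ℚ ℝ).injective)
  have hπ1 : ∀ q : ℚ, π (q : ℝ) = q := fun q => by
    simpa using LinearMap.congr_fun hπ q
  have hq : ∀ j, (d j : ℚ) = ∑ v ∈ b, π (c v) * (v j : ℚ) := fun j => by
    have h1 : ((d j : ℤ) : ℝ) = ∑ v ∈ b, c v * (v j : ℝ) := by
      have := congrFun hc j
      simpa [realVec, Finset.sum_apply] using this.symm
    have h2 := congrArg π h1
    rw [map_sum] at h2
    rw [show ((d j : ℤ) : ℝ) = ((d j : ℚ) : ℝ) by push_cast; rfl, hπ1] at h2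
    rw [h2]
    refine Finset.sum_congr rfl fun v _ => ?_
    rw [show c v * (v j : ℝ) = (v j : ℚ) • c v by rw [Rat.smul_def]; push_cast; ring, map_smul,
      smul_eq_mul, mul_comm]
  refine ⟨∏ v ∈ b, (π (c v)).den, Finset.prod_pos fun v _ => (π (c v)).den_pos, ?_⟩
  have hz : ∀ v ∈ b, ∃ z : ℤ, (z : ℚ) = ((∏ w ∈ b, (π (c w)).den : ℕ) : ℚ) * π (c v) := by
    intro v hv
    refine ⟨(∏ w ∈ b.erase v, (π (c w)).den : ℕ) * (π (c v)).num, ?_⟩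
    rw [← Finset.mul_prod_erase b _ hv]
    push_cast
    conv_rhs => rw [mul_right_comm, mul_comm (((π (c v)).den : ℚ)), Rat.mul_den_eq_num]
    ring
  choose! z hz using hz
  have : (∏ v ∈ b, (π (c v)).den) • d = ∑ v ∈ b, z v • v := by
    funext j
    have : (((∏ v ∈ b, (π (c v)).den : ℕ) * d j : ℤ) : ℚ) = ((∑ v ∈ b, z v * v j : ℤ) : ℚ) := by
      rw [Int.cast_sum, Int.cast_mul, hq, Finset.mul_sum]
      refine Finset.sum_congr rfl fun v hv => ?_
      rw [Int.cast_mul, hz v hv]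
      push_cast
      ring
    simpa [Finset.sum_apply] using Int.cast_injective this
  rw [this]
  exact sum_mem fun v hv => zsmul_mem (AddSubgroup.subset_closure hv) _

theorem exists_finset_nsmul_mem_closure {D' D : Set (Fin n → ℤ)} (h : D' ⊆ D) :
    ∃ H : Finset (Fin n → ℤ), (H : Set (Fin n → ℤ)) ⊆ D ∧ H.card + spanRank D' ≤ spanRank D ∧
      ∀ d ∈ D, ∃ m : ℕ, 0 < m ∧ m • d ∈ AddSubgroup.closure (D' ∪ H) := by
  classical
  obtain ⟨b', hb', -, hs', hi'⟩ := exists_linearIndepOn_extension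
    (linearIndepOn_empty ℝ (realVec (n := n))) (Set.empty_subset D')
  obtain ⟨b, hb, hbb, hs, hi⟩ := exists_linearIndepOn_extension hi' (hb'.trans h)
  have hfin : b.Finite := hi.finite
  have hrank : ∀ {c C : Set (Fin n → ℤ)} (_ : c ⊆ C) (_ : LinearIndepOn ℝ realVec c)
      (_ : realVec '' C ⊆ Submodule.span ℝ (realVec '' c)), spanRank C = c.ncard := by
    intro c C hc hci hsp
    have : Submodule.span ℝ (realVec '' C) = Submodule.span ℝ (realVec '' c) :=
      le_antisymm (Submodule.span_le.2 hsp) (Submodule.span_mono (Set.image_mono hc))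
    have hf : Fintype c := @Fintype.ofFinite _ hci.finite
    have h2 : realVec '' c = Set.range fun x : c => realVec x := by
      rw [Set.image_eq_range]
    rw [spanRank, this, h2, finrank_span_eq_card hci, Set.ncard_eq_toFinset_card',
      Set.toFinset_card]
  refine ⟨(hfin.subset Set.sdiff_subset : (b \ b').Finite).toFinset, ?_, ?_, ?_⟩
  · simpa using Set.sdiff_subset.trans hb
  · rw [hrank hb hi hs, hrank hb' hi' hs',
      ← Set.ncard_eq_toFinset_card _ (hfin.subset Set.sdiff_subset),
      Set.ncard_sdiff_add_ncard_of_subset hbb hfin]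
  · intro d hd
    obtain ⟨m, hm, hmd⟩ := exists_nsmul_mem_closure_of_realVec_mem_span hfin.toFinset d (by
      simpa using hs ⟨d, hd, rfl⟩)
    refine ⟨m, hm, AddSubgroup.closure_mono ?_ hmd⟩
    intro v hv
    by_cases hv' : v ∈ b'
    · exact Or.inl (hb' hv')
    · exact Or.inr (by simpa [hv'] using hv)

end LatticeRank

section CommonZeros

variable {n k : ℕ}

/-- The differences of points of one of the supports `A i` with `i ∈ J`. -/
def diffs (A : Fin k → Finset (Fin n → ℤ)) (J : Finset (Fin k)) : Set (Fin n → ℤ) :=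
  {v | ∃ i ∈ J, ∃ a ∈ A i, ∃ b ∈ A i, v = a - b}

theorem diffs_mono (A : Fin k → Finset (Fin n → ℤ)) {J J' : Finset (Fin k)} (h : J ⊆ J') :
    diffs A J ⊆ diffs A J' := by
  rintro v ⟨i, hi, H⟩
  exact ⟨i, h hi, H⟩

variable {K E : Type*} [Field K] [Field E] [Algebra K E]

theorem mem_of_sum_mul_eq_zero (M : IntermediateField K E) {ι : Type*} [Fintype ι] (f α : ι → E)
    (h : ∑ c, f c * α c = 0) (hα : ∀ c, α c ∈ M) (b : ι) (hb : α b ≠ 0)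
    (hf : ∀ c, c ≠ b → α c ≠ 0 → f c ∈ M) : f b ∈ M := by
  classical
  rw [← Finset.add_sum_erase _ _ (Finset.mem_univ b)] at h
  rw [eq_div_of_mul_eq hb (eq_neg_of_add_eq_zero_left h)]
  refine div_mem (neg_mem (sum_mem fun c hc => ?_)) (hα b)
  by_cases h0 : α c = 0
  · simp [h0]
  · exact mul_mem (hf c (Finset.ne_of_mem_erase hc) h0) (hα c)

theorem ne_zero_of_map_add {P : (Fin n → ℤ) → E} (hP0 : P 0 = 1)
    (hP : ∀ a b, P (a + b) = P a * P b) (a : Fin n → ℤ) : P a ≠ 0 := by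
  intro h
  have := hP a (-a)
  rw [add_neg_cancel, hP0, h, zero_mul] at this
  exact one_ne_zero this

theorem mem_relAlgClosure_of_nsmul {P : (Fin n → ℤ) → E} (hP0 : P 0 = 1)
    (hP : ∀ a b, P (a + b) = P a * P b) {Y : Set E} {S : Set (Fin n → ℤ)}
    (hS : ∀ s ∈ S, P s ∈ relAlgClosure K Y) {d : Fin n → ℤ}
    (hd : ∃ m : ℕ, 0 < m ∧ m • d ∈ AddSubgroup.closure S) : P d ∈ relAlgClosure K Y := by
  obtain ⟨m, hm, hmd⟩ := hd
  have hpow : ∀ m : ℕ, P (m • d) = P d ^ m := fun m => by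
    induction m with
    | zero => simp [hP0]
    | succ m ih => rw [succ_nsmul, hP, ih, pow_succ]
  refine mem_relAlgClosure_of_pow hm ?_
  rw [← hpow]
  generalize m • d = e at hmd
  induction hmd using AddSubgroup.closure_induction with
  | mem s hs => exact hS s hs
  | zero => rw [hP0]; exact one_mem _
  | add a b _ _ ha hb => rw [hP]; exact mul_mem ha hb
  | neg a _ ha =>
    have : P (-a) = (P a)⁻¹ := by
      apply eq_inv_of_mul_eq_one_left
      rw [← hP, neg_add_cancel, hP0]
    rw [this]
    exact inv_mem ha

/-- If the coefficients `f` satisfy, besides the equations given by a character `P`, the equations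
twisted by a function `θ` that vanishes on the differences of a proper subcollection `J` at most,
then the transcendence degree of `f` drops. -/
theorem exists_small_generating_finset (A : Fin k → Finset (Fin n → ℤ))
    (hA : ∀ i, (A i).Nonempty)
    (hess : ∀ J : Finset (Fin k), J ⊂ Finset.univ →
      spanRank (diffs A Finset.univ) + J.card < spanRank (diffs A J) + k)
    {P : (Fin n → ℤ) → E} (hP0 : P 0 = 1) (hP : ∀ a b, P (a + b) = P a * P b)
    (f : ∀ i, {x // x ∈ A i} → E)
    (hf : ∀ i (c : {x // x ∈ A i}), ∑ a, f i a * P (a - c) = 0)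
    {θ : (Fin n → ℤ) → E} (hθ0 : θ 0 = 0)
    (hθ : ∀ i (c : {x // x ∈ A i}), ∑ a, f i a * (P (a - c) * θ (a - c)) = 0)
    {J : Finset (Fin k)} (hJ : J ⊂ Finset.univ)
    (hJθ : ∀ i ∉ J, ∃ a ∈ A i, ∃ b ∈ A i, θ (b - a) ≠ 0)
    (H : Finset E) (hHcard : H.card + spanRank (diffs A J) ≤ spanRank (diffs A Finset.univ))
    (hH : ∀ Y : Set E, (H : Set E) ⊆ relAlgClosure K Y →
      ∀ d ∈ diffs A Finset.univ, θ d ∈ relAlgClosure K Y) :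
    ∃ Y : Finset E, Y.card + k < ∑ i, (A i).card + spanRank (diffs A Finset.univ) ∧
      (∀ i a, f i a ∈ relAlgClosure K (Y : Set E)) ∧
      ∀ d ∈ diffs A Finset.univ, P d ∈ relAlgClosure K (Y : Set E) := by
  classical
  obtain ⟨H₀, -, hH₀card, hH₀⟩ :=
    exists_finset_nsmul_mem_closure (Set.empty_subset (diffs A Finset.univ))
  have hab : ∀ i, ∃ a b : {x // x ∈ A i}, (i ∈ J → b = a) ∧ (i ∉ J → θ (b - a) ≠ 0) := by
    intro i
    by_cases hi : i ∈ J
    · obtain ⟨a, ha⟩ := hA i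
      exact ⟨⟨a, ha⟩, ⟨a, ha⟩, fun _ => rfl, fun h => (h hi).elim⟩
    · obtain ⟨a, ha, b, hb, hab⟩ := hJθ i hi
      exact ⟨⟨a, ha⟩, ⟨b, hb⟩, fun h => (hi h).elim, fun _ => hab⟩
  choose a b hJab hJab' using hab
  let W : ∀ i, Finset {x // x ∈ A i} := fun i => {a i, b i}ᶜ
  let V := (Finset.univ.sigma W).image fun v => f v.1 v.2
  let Y := H ∪ H₀.image P ∪ V
  have hcard : ∑ i, (A i).card + J.card = ∑ i, (W i).card + 2 * k := by
    have h1 : ∀ i, (A i).card + (if i ∈ J then 1 else 0) = (W i).card + 2 := by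
      intro i
      have h2 := Finset.card_compl_add_card ({a i, b i} : Finset {x // x ∈ A i})
      rw [Fintype.card_coe] at h2
      change (W i).card + _ = _ at h2
      by_cases hi : i ∈ J
      · rw [hJab i hi] at h2
        simp only [Finset.insert_eq_of_mem, Finset.mem_singleton, Finset.card_singleton] at h2
        rw [if_pos hi]
        omega
      · have hne : a i ≠ b i := by
          intro h
          apply hJab' i hi
          rw [h, sub_self, hθ0]
        rw [Finset.card_pair hne] at h2
        rw [if_neg hi]
        omega
    have h3 := Finset.sum_congr (rfl : (Finset.univ : Finset (Fin k)) = _) fun i _ => h1 i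
    rw [Finset.sum_add_distrib, Finset.sum_add_distrib, Finset.sum_ite_mem] at h3
    simp only [Finset.univ_inter, Finset.sum_const, smul_eq_mul, mul_one, Finset.card_univ,
      Fintype.card_fin] at h3
    omega
  have hVcard : V.card ≤ ∑ i, (W i).card := Finset.card_image_le.trans (Finset.card_sigma _ _).le
  have hYcard : Y.card ≤ H.card + H₀.card + V.card :=
    (Finset.card_union_le _ _).trans (Nat.add_le_add_right ((Finset.card_union_le _ _).trans
      (Nat.add_le_add_left Finset.card_image_le _)) _)
  have hY : (Y : Set E) ⊆ relAlgClosure K (Y : Set E) := subset_relAlgClosure _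
  have hdiff : ∀ i (x y : {x // x ∈ A i}), (x - y : Fin n → ℤ) ∈ diffs A Finset.univ :=
    fun i x y => ⟨i, Finset.mem_univ i, x, x.2, y, y.2, rfl⟩
  have hPd : ∀ d ∈ diffs A Finset.univ, P d ∈ relAlgClosure K (Y : Set E) := by
    intro d hd
    refine mem_relAlgClosure_of_nsmul hP0 hP (fun s hs => hY ?_) (hH₀ d hd)
    have hs' : s ∈ H₀ := by simpa using hs
    exact Finset.mem_union_left _ (Finset.mem_union_right _ (Finset.mem_image_of_mem P hs'))
  have hθd := hH Y fun x hx => hY (Finset.mem_union_left _ (Finset.mem_union_left _ hx))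
  have hfW : ∀ i c, c ≠ a i → c ≠ b i → f i c ∈ relAlgClosure K (Y : Set E) := by
    intro i c hca hcb
    refine hY (Finset.mem_union_right _ (Finset.mem_image.2 ⟨⟨i, c⟩, ?_, rfl⟩))
    simp [W, hca, hcb]
  have hfb : ∀ i, i ∉ J → f i (b i) ∈ relAlgClosure K (Y : Set E) := by
    intro i hi
    refine mem_of_sum_mul_eq_zero _ (f i) _ (hθ i (a i))
      (fun c => mul_mem (hPd _ (hdiff i _ _)) (hθd _ (hdiff i _ _))) _
      (mul_ne_zero (ne_zero_of_map_add hP0 hP _) (hJab' i hi)) fun c hc h0 => hfW i c ?_ hc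
    rintro rfl
    simp [hθ0] at h0
  refine ⟨Y, ?_, fun i c => ?_, hPd⟩
  · have := hess J hJ
    omega
  · by_cases hca : c = a i
    · rw [hca]
      refine mem_of_sum_mul_eq_zero _ (f i) _ (hf i (a i)) (fun c => hPd _ (hdiff i _ _)) _
        (ne_zero_of_map_add hP0 hP _) fun c hc _ => ?_
      by_cases hcb : c = b i
      · by_cases hi : i ∈ J
        · exact (hc (hcb.trans (hJab i hi))).elim
        · exact hcb ▸ hfb i hi
      · exact hfW i c hc hcb
    · by_cases hcb : c = b i
      · by_cases hi : i ∈ J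
        · exact (hca (hcb.trans (hJab i hi))).elim
        · exact hcb ▸ hfb i hi
      · exact hfW i c hca hcb

end CommonZeros

section Dominance

variable {n k : ℕ} {K E : Type*} [Field K] [Field E] [Algebra K E]

theorem spanRank_le (D : Set (Fin n → ℤ)) : spanRank D ≤ n := by
  rw [spanRank]
  simpa using Submodule.finrank_le (Submodule.span ℝ (realVec '' D))

theorem map_mem_of_nsmul [CharZero E] {M : IntermediateField K E} {l : (Fin n → ℤ) →+ E}
    {S : Set (Fin n → ℤ)} (hS : ∀ s ∈ S, l s ∈ M) {d : Fin n → ℤ}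
    (hd : ∃ m : ℕ, 0 < m ∧ m • d ∈ AddSubgroup.closure S) : l d ∈ M := by
  obtain ⟨m, hm, hmd⟩ := hd
  have h : AddSubgroup.closure S ≤ M.toSubfield.toSubring.toAddSubgroup.comap l :=
    (AddSubgroup.closure_le _).2 hS
  have h1 : l (m • d) ∈ M := h hmd
  rw [map_nsmul, nsmul_eq_mul] at h1
  have hm0 : (m : E) ≠ 0 := Nat.cast_ne_zero.2 hm.ne'
  have h2 := div_mem h1 (natCast_mem M m)
  rwa [mul_div_cancel_left₀ _ hm0] at h2

theorem isAlgebraic_of_derivation_eq_zero [CharZero K] [Algebra.EssFiniteType K E]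
    (h : ∀ δ : Derivation K E E, δ = 0) : Algebra.IsAlgebraic K E := by
  have hsub : Subsingleton (Ω[E⁄K]) := by
    by_contra hns
    rw [not_subsingleton_iff_nontrivial] at hns
    obtain ⟨x, hx⟩ := exists_ne (0 : Ω[E⁄K])
    refine hx ((Module.forall_dual_apply_eq_zero_iff E x).1 fun φ => ?_)
    have h0 : φ = 0 := (KaehlerDifferential.linearMapEquivDerivation K E).injective
      ((h _).trans (h _).symm)
    rw [h0, LinearMap.zero_apply]
  have : Algebra.FormallyUnramified K E := ⟨hsub⟩
  have := Algebra.FormallyUnramified.isSeparable K E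
  infer_instance

/-- The kernel of a derivation of a field, as an intermediate field. -/
def Derivation.kerField (δ : Derivation K E E) : IntermediateField K E where
  carrier := {x | δ x = 0}
  mul_mem' {x y} hx hy := by
    have hx' : δ x = 0 := hx
    have hy' : δ y = 0 := hy
    simp [Derivation.leibniz, hx', hy']
  add_mem' {x y} hx hy := by
    have hx' : δ x = 0 := hx
    have hy' : δ y = 0 := hy
    simp [hx', hy']
  algebraMap_mem' r := δ.map_algebraMap r
  inv_mem' x hx := by
    have hx' : δ x = 0 := hx
    simp [Derivation.leibniz_inv, hx']

/-- The logarithmic derivative of a character `P` along a derivation. -/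
def Derivation.logHom (δ : Derivation K E E) {P : (Fin n → ℤ) → E} (hP0 : P 0 = 1)
    (hP : ∀ a b, P (a + b) = P a * P b) : (Fin n → ℤ) →+ E where
  toFun a := δ (P a) / P a
  map_zero' := by simp [hP0]
  map_add' a b := by
    have ha := ne_zero_of_map_add hP0 hP a
    have hb := ne_zero_of_map_add hP0 hP b
    rw [hP, Derivation.leibniz, smul_eq_mul, smul_eq_mul]
    field_simp
    ring

theorem Derivation.logHom_apply (δ : Derivation K E E) {P : (Fin n → ℤ) → E} (hP0 : P 0 = 1)
    (hP : ∀ a b, P (a + b) = P a * P b) (a : Fin n → ℤ) :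
    δ.logHom hP0 hP a = δ (P a) / P a :=
  rfl

theorem Derivation.eq_zero_of_generators [CharZero E] (δ : Derivation K E E)
    {P : (Fin n → ℤ) → E} (hP0 : P 0 = 1) (hP : ∀ a b, P (a + b) = P a * P b)
    {S : Set (Fin n → ℤ)} (hS : ∀ a, ∃ m : ℕ, 0 < m ∧ m • a ∈ AddSubgroup.closure S)
    {ι : Type*} (f : ι → E)
    (hgen : ∀ M : IntermediateField K E, (∀ a, P a ∈ M) → (∀ i, f i ∈ M) → M = ⊤)
    (hδS : ∀ s ∈ S, δ (P s) = 0) (hδf : ∀ i, δ (f i) = 0) : δ = 0 := by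
  have hδP : ∀ a, δ (P a) = 0 := by
    intro a
    obtain ⟨m, hm, hma⟩ := hS a
    have h1 : AddSubgroup.closure S ≤ (δ.logHom hP0 hP).ker :=
      (AddSubgroup.closure_le _).2 fun s hs => by
        change δ.logHom hP0 hP s = 0
        rw [Derivation.logHom_apply, hδS s hs, zero_div]
    have h2 : δ.logHom hP0 hP (m • a) = 0 := h1 hma
    rw [map_nsmul, nsmul_eq_mul, Derivation.logHom_apply] at h2
    have h3 := (mul_eq_zero.1 h2).resolve_left (Nat.cast_ne_zero.2 hm.ne')
    exact (div_eq_zero_iff.1 h3).resolve_right (ne_zero_of_map_add hP0 hP a)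
  have htop := hgen δ.kerField hδP hδf
  ext y
  have : y ∈ δ.kerField := htop ▸ IntermediateField.mem_top
  exact this

theorem exists_small_generating_finset_of_derivation [CharZero E]
    (A : Fin k → Finset (Fin n → ℤ)) (hA : ∀ i, (A i).Nonempty)
    (hess : ∀ J : Finset (Fin k), J ⊂ Finset.univ →
      spanRank (diffs A Finset.univ) + J.card < spanRank (diffs A J) + k)
    {P : (Fin n → ℤ) → E} (hP0 : P 0 = 1) (hP : ∀ a b, P (a + b) = P a * P b)
    (f : ∀ i, {x // x ∈ A i} → E)
    (hf : ∀ i (c : {x // x ∈ A i}), ∑ a, f i a * P (a - c) = 0)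
    (δ : Derivation K E E) (hδf : ∀ i a, δ (f i a) = 0)
    (hδP : ∃ d ∈ diffs A Finset.univ, δ (P d) ≠ 0) :
    ∃ Y : Finset E, Y.card + k < ∑ i, (A i).card + spanRank (diffs A Finset.univ) ∧
      (∀ i a, f i a ∈ relAlgClosure K (Y : Set E)) ∧
      ∀ d ∈ diffs A Finset.univ, P d ∈ relAlgClosure K (Y : Set E) := by
  classical
  have hne := ne_zero_of_map_add hP0 hP
  let l : (Fin n → ℤ) →+ E := δ.logHom hP0 hP
  have hl : ∀ a, l a = δ (P a) / P a := fun _ => rfl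
  let J : Finset (Fin k) := Finset.univ.filter fun i => ∀ a ∈ A i, ∀ b ∈ A i, l (b - a) = 0
  have hlJ : ∀ d ∈ diffs A J, l d = 0 := by
    rintro _ ⟨i, hi, a, ha, b, hb, rfl⟩
    exact (Finset.mem_filter.1 hi).2 b hb a ha
  have hJ : J ⊂ Finset.univ := by
    rw [Finset.ssubset_univ_iff]
    rintro hJ
    obtain ⟨d, hd, hne'⟩ := hδP
    exact div_ne_zero hne' (hne d) (hlJ d (hJ ▸ hd))
  obtain ⟨H, -, hHcard, hH⟩ := exists_finset_nsmul_mem_closure (diffs_mono A hJ.subset)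
  refine exists_small_generating_finset (K := K) A hA hess hP0 hP f hf
    (θ := l) (map_zero l) (fun i c => ?_) hJ (fun i hi => ?_) (H.image l)
    ((Nat.add_le_add_right Finset.card_image_le _).trans hHcard) fun Y hY d hd => ?_
  · have h1 := congrArg δ (hf i c)
    rw [map_sum, map_zero] at h1
    rw [← h1]
    refine Finset.sum_congr rfl fun a _ => ?_
    rw [Derivation.leibniz, hδf, smul_zero, add_zero, hl, mul_div_cancel₀ _ (hne _),
      smul_eq_mul]
  · have : ¬ ∀ a ∈ A i, ∀ b ∈ A i, l (b - a) = 0 := fun h =>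
      hi (Finset.mem_filter.2 ⟨Finset.mem_univ i, h⟩)
    push Not at this
    exact this
  · refine map_mem_of_nsmul ?_ (hH d hd)
    rintro s (hs | hs)
    · rw [hlJ s hs]
      exact zero_mem _
    · exact hY (Finset.mem_coe.2 (Finset.mem_image_of_mem _ hs))

theorem isAlgebraic_of_mem_of_not_exists_small [CharZero K] [Algebra.EssFiniteType K E]
    (A : Fin k → Finset (Fin n → ℤ)) (hA : ∀ i, (A i).Nonempty)
    (hess : ∀ J : Finset (Fin k), J ⊂ Finset.univ →
      spanRank (diffs A Finset.univ) + J.card < spanRank (diffs A J) + k)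
    {P : (Fin n → ℤ) → E} (hP0 : P 0 = 1) (hP : ∀ a b, P (a + b) = P a * P b)
    (f : ∀ i, {x // x ∈ A i} → E)
    (hf : ∀ i (c : {x // x ∈ A i}), ∑ a, f i a * P (a - c) = 0)
    (hgen : ∀ M : IntermediateField K E, (∀ a, P a ∈ M) → (∀ i a, f i a ∈ M) → M = ⊤)
    {C : Set (Fin n → ℤ)}
    (hC : ∀ a, ∃ m : ℕ, 0 < m ∧ m • a ∈ AddSubgroup.closure (diffs A Finset.univ ∪ C))
    (hsmall : ∀ Y : Finset E, (∀ i a, f i a ∈ relAlgClosure K (Y : Set E)) →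
      (∀ d ∈ diffs A Finset.univ, P d ∈ relAlgClosure K (Y : Set E)) →
      ∑ i, (A i).card + spanRank (diffs A Finset.univ) ≤ Y.card + k)
    (M : IntermediateField K E) (hfM : ∀ i a, f i a ∈ M) (hCM : ∀ c ∈ C, P c ∈ M) :
    Algebra.IsAlgebraic M E := by
  have : CharZero E := charZero_of_injective_algebraMap (algebraMap K E).injective
  have : Algebra.EssFiniteType M E := Algebra.EssFiniteType.of_comp K M E
  refine isAlgebraic_of_derivation_eq_zero fun δ => ?_
  have hδM : ∀ y ∈ M, δ y = 0 := fun y hy => δ.map_algebraMap ⟨y, hy⟩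
  have h0 : δ.restrictScalars K = 0 := by
    by_cases hδd : ∃ d ∈ diffs A Finset.univ, δ.restrictScalars K (P d) ≠ 0
    · obtain ⟨Y, hYcard, hYf, hYP⟩ := exists_small_generating_finset_of_derivation A hA hess
        hP0 hP f hf (δ.restrictScalars K) (fun i a => hδM _ (hfM i a)) hδd
      exact ((hsmall Y hYf hYP).not_gt hYcard).elim
    · push Not at hδd
      exact Derivation.eq_zero_of_generators _ hP0 hP hC
        (fun v : (i : Fin k) × {x // x ∈ A i} => f v.1 v.2)
        (fun M hM hM' => hgen M hM fun i a => hM' ⟨i, a⟩)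
        (fun s hs => hs.elim (hδd s) fun hs => hδM _ (hCM s hs)) fun v => hδM _ (hfM v.1 v.2)
  ext y
  exact DFunLike.congr_fun h0 y

theorem le_card_add_of_mem_relAlgClosure [CharZero K] [Algebra.EssFiniteType K E]
    (A : Fin k → Finset (Fin n → ℤ)) (hA : ∀ i, (A i).Nonempty)
    (hess : ∀ J : Finset (Fin k), J ⊂ Finset.univ →
      spanRank (diffs A Finset.univ) + J.card < spanRank (diffs A J) + k)
    {P : (Fin n → ℤ) → E} (hP0 : P 0 = 1) (hP : ∀ a b, P (a + b) = P a * P b)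
    (f : ∀ i, {x // x ∈ A i} → E)
    (hf : ∀ i (c : {x // x ∈ A i}), ∑ a, f i a * P (a - c) = 0)
    (hgen : ∀ M : IntermediateField K E, (∀ a, P a ∈ M) → (∀ i a, f i a ∈ M) → M = ⊤)
    {ι : Type*} [Fintype ι] {x : ι → E} (hx : AlgebraicIndependent K x)
    (hι : Fintype.card ι + k = n + ∑ i, (A i).card)
    (T : Finset ((i : Fin k) × {x // x ∈ A i}))
    (hT : ∀ i a, f i a ∈ relAlgClosure K
      ((fun v : (i : Fin k) × {x // x ∈ A i} => f v.1 v.2) '' (T : Set _))) :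
    ∑ i, (A i).card + spanRank (diffs A Finset.univ) ≤ T.card + k := by
  classical
  have : CharZero E := charZero_of_injective_algebraMap (algebraMap K E).injective
  obtain ⟨C, -, hCcard, hC⟩ :=
    exists_finset_nsmul_mem_closure (Set.subset_univ (diffs A Finset.univ))
  have hCn := hCcard.trans (spanRank_le _)
  have hgenY : ∀ Y : Finset E, (∀ i a, f i a ∈ relAlgClosure K (Y : Set E)) →
      (∀ d ∈ diffs A Finset.univ, P d ∈ relAlgClosure K (Y : Set E)) →
      n + ∑ i, (A i).card ≤ Y.card + C.card + k := by
    intro Y hfY hPY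
    have hsub : relAlgClosure K (Y : Set E) ≤ relAlgClosure K (↑(Y ∪ C.image P) : Set E) :=
      relAlgClosure_le fun y hy => subset_relAlgClosure _ (by simp [Finset.mem_coe.1 hy])
    have htop : relAlgClosure K (↑(Y ∪ C.image P) : Set E) = ⊤ := by
      refine hgen _ (fun a => ?_) fun i a => hsub (hfY i a)
      refine mem_relAlgClosure_of_nsmul hP0 hP ?_ (hC a (Set.mem_univ a))
      rintro s (hs | hs)
      · exact hsub (hPY s hs)
      · exact subset_relAlgClosure _ (by
          simpa using Or.inr ⟨s, by simpa using hs, rfl⟩)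
    have h1 := hx.card_le_of_mem_relAlgClosure (Y ∪ C.image P) fun i => by
      rw [htop]
      exact IntermediateField.mem_top
    have h2 := Finset.card_union_le Y (C.image P)
    have h3 := Finset.card_image_le (s := C) (f := P)
    omega
  let Y : Finset E := T.image (fun v => f v.1 v.2) ∪ C.image P
  have hfY : ∀ i a, f i a ∈ relAlgClosure K (Y : Set E) := fun i a => by
    refine relAlgClosure_le ?_ (hT i a)
    rintro _ ⟨t, ht, rfl⟩
    exact subset_relAlgClosure _ (Finset.mem_coe.2 (Finset.mem_union_left _
      (Finset.mem_image_of_mem (fun v => f v.1 v.2) (Finset.mem_coe.1 ht))))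
  have hCY : ∀ c ∈ C, P c ∈ relAlgClosure K (Y : Set E) := fun c hc =>
    subset_relAlgClosure _ (Finset.mem_coe.2 (Finset.mem_union_right _
      (Finset.mem_image_of_mem P hc)))
  have halg := isAlgebraic_of_mem_of_not_exists_small A hA hess hP0 hP f hf hgen
    (fun a => hC a (Set.mem_univ a))
    (fun Y hYf hYP => by
      have := hgenY Y hYf hYP
      omega) _ hfY hCY
  have h1 := hx.card_le_of_mem_relAlgClosure Y fun i =>
    mem_relAlgClosure_of_isAlgebraic le_rfl (halg.isAlgebraic (x i))
  have h2 : Y.card ≤ _ := Finset.card_union_le _ _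
  have h3 := Finset.card_image_le (s := C) (f := P)
  have h4 := Finset.card_image_le (s := T) (f := fun v => f v.1 v.2)
  omega

theorem exists_small_generating_finset_of_two_zeros (A : Fin k → Finset (Fin n → ℤ))
    (hA : ∀ i, (A i).Nonempty)
    (hess : ∀ J : Finset (Fin k), J ⊂ Finset.univ →
      spanRank (diffs A Finset.univ) + J.card < spanRank (diffs A J) + k)
    {P Q : (Fin n → ℤ) → E} (hP0 : P 0 = 1) (hP : ∀ a b, P (a + b) = P a * P b)
    (hQ0 : Q 0 = 1) (hQ : ∀ a b, Q (a + b) = Q a * Q b)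
    (f : ∀ i, {x // x ∈ A i} → E)
    (hfP : ∀ i (c : {x // x ∈ A i}), ∑ a, f i a * P (a - c) = 0)
    (hfQ : ∀ i (c : {x // x ∈ A i}), ∑ a, f i a * Q (a - c) = 0)
    (hPQ : ∃ d ∈ diffs A Finset.univ, P d ≠ Q d) :
    ∃ Y : Finset E, Y.card + k < ∑ i, (A i).card + spanRank (diffs A Finset.univ) ∧
      ∀ i a, f i a ∈ relAlgClosure K (Y : Set E) := by
  classical
  have hne := ne_zero_of_map_add hP0 hP
  let τ : (Fin n → ℤ) → E := fun a => Q a / P a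
  have hτ0 : τ 0 = 1 := by simp [τ, hP0, hQ0]
  have hτ : ∀ a b, τ (a + b) = τ a * τ b := fun a b => by
    simp only [τ, hP, hQ, mul_div_mul_comm]
  let θ : (Fin n → ℤ) → E := fun a => τ a - 1
  let J : Finset (Fin k) := Finset.univ.filter fun i => ∀ a ∈ A i, ∀ b ∈ A i, θ (b - a) = 0
  have hθJ : ∀ d ∈ diffs A J, θ d = 0 := by
    rintro _ ⟨i, hi, a, ha, b, hb, rfl⟩
    exact (Finset.mem_filter.1 hi).2 b hb a ha
  have hJ : J ⊂ Finset.univ := by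
    rw [Finset.ssubset_univ_iff]
    rintro hJ
    obtain ⟨d, hd, hne'⟩ := hPQ
    have h1 : Q d / P d - 1 = 0 := hθJ d (hJ ▸ hd)
    rw [sub_eq_zero, div_eq_one_iff_eq (hne d)] at h1
    exact hne' h1.symm
  obtain ⟨H, -, hHcard, hH⟩ := exists_finset_nsmul_mem_closure (diffs_mono A hJ.subset)
  obtain ⟨Y, hYcard, hYf, -⟩ := exists_small_generating_finset (K := K) A hA hess hP0 hP f hfP
    (θ := θ) (by simp [θ, hτ0]) (fun i c => by
      have h1 : ∀ a : {x // x ∈ A i}, f i a * (P (a - c) * θ (a - c)) =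
          f i a * Q (a - c) - f i a * P (a - c) := fun a => by
        have := hne (a - c)
        simp only [θ, τ]
        field_simp
      rw [Finset.sum_congr rfl fun a _ => h1 a, Finset.sum_sub_distrib, hfP, hfQ, sub_zero]) hJ
    (fun i hi => by
      have : ¬ ∀ a ∈ A i, ∀ b ∈ A i, θ (b - a) = 0 := fun h =>
        hi (Finset.mem_filter.2 ⟨Finset.mem_univ i, h⟩)
      push Not at this
      exact this) (H.image θ)
    ((Nat.add_le_add_right Finset.card_image_le _).trans hHcard)
    (fun Y hY d hd => by
      refine sub_mem (mem_relAlgClosure_of_nsmul hτ0 hτ ?_ (hH d hd)) (one_mem _)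
      have hτθ : ∀ s, τ s = θ s + 1 := fun s => (sub_add_cancel _ _).symm
      rintro s (hs | hs)
      · rw [hτθ, hθJ s hs, zero_add]
        exact one_mem _
      · rw [hτθ]
        exact add_mem (hY (by simpa using ⟨s, by simpa using hs, rfl⟩)) (one_mem _))
  exact ⟨Y, hYcard, hYf⟩

end Dominance

section GenericPoint

theorem exists_prime_algebraicIndependent {Z : Type*} {R : Subalgebra ℂ (Z → ℂ)} (hR : R.FG)
    {ι : Type*} (y : ι → R)
    (h : ∀ G : MvPolynomial ι ℂ,
      (∀ z, MvPolynomial.eval (fun i => (y i : Z → ℂ) z) G = 0) → G = 0) :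
    ∃ P : Ideal R, P.IsPrime ∧ AlgebraicIndependent ℂ fun i => Ideal.Quotient.mk P (y i) := by
  classical
  by_contra! hcon
  have : Algebra.FiniteType ℂ R := (Subalgebra.fg_iff_finiteType R).1 hR
  have : IsNoetherianRing R := Algebra.FiniteType.isNoetherianRing ℂ R
  have hfin := minimalPrimes.finite_of_isNoetherianRing R
  have hG : ∀ P : Ideal R, P.IsPrime →
      ∃ G : MvPolynomial ι ℂ, G ≠ 0 ∧ MvPolynomial.aeval y G ∈ P := by
    intro P hP
    have := hcon P hP
    rw [algebraicIndependent_iff] at this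
    push Not at this
    obtain ⟨G, hG, hG0⟩ := this
    refine ⟨G, hG0, ?_⟩
    rw [← Ideal.Quotient.eq_zero_iff_mem, ← hG]
    have hφ : (Ideal.Quotient.mkₐ ℂ P).comp (MvPolynomial.aeval y) =
        MvPolynomial.aeval fun i => Ideal.Quotient.mk P (y i) :=
      MvPolynomial.algHom_ext fun i => by simp
    exact DFunLike.congr_fun hφ G
  choose! G hG0 hGP using hG
  have hprod : MvPolynomial.aeval y (∏ P ∈ hfin.toFinset, G P) ∈ (⊥ : Ideal R).radical := by
    rw [← Ideal.sInf_minimalPrimes, Ideal.mem_sInf]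
    intro P hP
    have hP' : P ∈ hfin.toFinset := hfin.mem_toFinset.2 hP
    rw [map_prod]
    exact Ideal.prod_mem P hP' (hGP P hP.1.1)
  obtain ⟨m, hm⟩ := hprod
  refine Finset.prod_ne_zero_iff.2 (fun P hP => hG0 P ((hfin.mem_toFinset.1 hP).1.1))
    (h (∏ P ∈ hfin.toFinset, G P) fun z => ?_)
  have hz : (MvPolynomial.eval (fun i => (y i : Z → ℂ) z) (∏ P ∈ hfin.toFinset, G P)) ^ m = 0 := by
    let φ : R →ₐ[ℂ] ℂ := (Pi.evalAlgHom ℂ (fun _ : Z => ℂ) z).comp R.val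
    have h1 := congrArg φ (show _ = (0 : R) from hm)
    rw [map_pow, map_zero, MvPolynomial.comp_aeval_apply] at h1
    exact h1
  exact eq_zero_of_pow_eq_zero hz

theorem exists_field_of_isDomain (B : Type) [CommRing B] [IsDomain B] [Algebra ℂ B]
    [Algebra.FiniteType ℂ B] {ι : Type*} {y : ι → B} (hy : AlgebraicIndependent ℂ y) :
    ∃ (E : Type) (_ : Field E) (_ : Algebra ℂ E) (φ : B →ₐ[ℂ] E), Algebra.EssFiniteType ℂ E ∧
      (∀ M : IntermediateField ℂ E, (∀ r, φ r ∈ M) → M = ⊤) ∧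
      AlgebraicIndependent ℂ fun i => φ (y i) := by
  have : Algebra.EssFiniteType B (FractionRing B) :=
    Algebra.EssFiniteType.of_isLocalization _ (nonZeroDivisors B)
  refine ⟨FractionRing B, inferInstance, inferInstance,
    IsScalarTower.toAlgHom ℂ B (FractionRing B), Algebra.EssFiniteType.comp ℂ B _,
    fun M hM => eq_top_iff.2 fun x _ => ?_, hy.map' (IsFractionRing.injective _ _)⟩
  obtain ⟨a, b, -, rfl⟩ := IsFractionRing.div_surjective (A := B) x
  exact div_mem (hM a) (hM b)

theorem exists_field_algebraicIndependent {Z : Type} {R : Subalgebra ℂ (Z → ℂ)} (hR : R.FG)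
    {ι : Type*} (y : ι → R)
    (h : ∀ G : MvPolynomial ι ℂ,
      (∀ z, MvPolynomial.eval (fun i => (y i : Z → ℂ) z) G = 0) → G = 0) :
    ∃ (E : Type) (_ : Field E) (_ : Algebra ℂ E) (φ : R →ₐ[ℂ] E), Algebra.EssFiniteType ℂ E ∧
      (∀ M : IntermediateField ℂ E, (∀ r, φ r ∈ M) → M = ⊤) ∧
      AlgebraicIndependent ℂ fun i => φ (y i) := by
  obtain ⟨P, hP, hy⟩ := exists_prime_algebraicIndependent hR y h
  have : Algebra.FiniteType ℂ R := (Subalgebra.fg_iff_finiteType R).1 hR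
  obtain ⟨E, _, _, φ, hE, hφ, hφy⟩ := exists_field_of_isDomain (R ⧸ P) hy
  exact ⟨E, inferInstance, inferInstance, φ.comp (Ideal.Quotient.mkₐ ℂ P), hE, fun M hM =>
    hφ M fun r => by
      obtain ⟨r, rfl⟩ := Ideal.Quotient.mk_surjective r
      exact hM r, hφy⟩

end GenericPoint

section Monomials

variable {n k : ℕ}

theorem mon_zero (p : Fin n → ℂˣ) : mon p 0 = 1 := by
  simp [mon]

theorem mon_add (p : Fin n → ℂˣ) (a b : Fin n → ℤ) : mon p (a + b) = mon p a * mon p b := by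
  simp [mon, zpow_add, Finset.prod_mul_distrib]

theorem mon_mul (p q : Fin n → ℂˣ) (a : Fin n → ℤ) : mon (p * q) a = mon p a * mon q a := by
  simp [mon, mul_zpow, Finset.prod_mul_distrib]

theorem mon_sub (p : Fin n → ℂˣ) (a b : Fin n → ℤ) : mon p (a - b) = mon p a / mon p b := by
  rw [eq_div_iff_mul_eq', ← mon_add, sub_add_cancel]

theorem mon_inv (p : Fin n → ℂˣ) (a : Fin n → ℤ) : mon p⁻¹ a = (mon p a)⁻¹ := by
  simp [mon]

theorem sum_mul_mon_sub_eq_zero {A : Finset (Fin n → ℤ)} {f : {x // x ∈ A} → ℂ} {p : Fin n → ℂˣ}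
    (h : evalL f p = 0) (c : Fin n → ℤ) : ∑ a, f a * (mon p (a - c) : ℂ) = 0 := by
  have h1 : ∑ a, f a * (mon p (a - c) : ℂ) = evalL f p / (mon p c : ℂ) := by
    rw [evalL, Finset.sum_div]
    exact Finset.sum_congr rfl fun a _ => by rw [mon_sub, Units.val_div_eq_div_val, mul_div_assoc]
  rw [h1, h, zero_div]

theorem evalL_mul_of_inKer {A : Fin k → Finset (Fin n → ℤ)} (hA : ∀ i, (A i).Nonempty)
    {t : Fin n → ℂˣ} (ht : inKer A t) (i : Fin k) (f : {x // x ∈ A i} → ℂ) {p : Fin n → ℂˣ}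
    (hp : evalL f p = 0) : evalL f (p * t) = 0 := by
  obtain ⟨b, hb⟩ := hA i
  have h1 : evalL f (p * t) = evalL f p * (mon t b : ℂ) := by
    rw [evalL, evalL, Finset.sum_mul]
    refine Finset.sum_congr rfl fun a _ => ?_
    have h2 := ht i a a.2 b hb
    rw [mon_sub, div_eq_one] at h2
    rw [mon_mul, Units.val_mul, mul_assoc, h2]
  rw [h1, hp, zero_mul]

variable {Z : Type*} {R : Subalgebra ℂ (Z → ℂ)}

theorem exists_mon_mem (p : Z → Fin n → ℂˣ) (hp : ∀ j, (fun z => (p z j : ℂ)) ∈ R)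
    (hp' : ∀ j, (fun z => (p z j : ℂ)⁻¹) ∈ R) :
    ∃ χ : (Fin n → ℤ) → R, (∀ a z, (χ a : Z → ℂ) z = mon (p z) a) ∧ χ 0 = 1 ∧
      ∀ a b, χ (a + b) = χ a * χ b := by
  have hmem : ∀ a, (fun z => (mon (p z) a : ℂ)) ∈ R := by
    intro a
    have h1 : (fun z => (mon (p z) a : ℂ)) = ∏ j, fun z => (p z j : ℂ) ^ a j := by
      ext z
      simp [mon]
    rw [h1]
    refine prod_mem fun j _ => ?_
    obtain ⟨m, hm | hm⟩ := (a j).eq_nat_or_neg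
    · simp only [hm, zpow_natCast]
      exact pow_mem (hp j) m
    · simp only [hm, zpow_neg, zpow_natCast, ← inv_pow]
      exact pow_mem (hp' j) m
  refine ⟨fun a => ⟨_, hmem a⟩, fun _ _ => rfl, ?_, fun a b => ?_⟩
  · ext z
    simp [mon_zero]
  · ext z
    simp [mon_add]

theorem sum_mul_mon_mem_eq_zero {A : Finset (Fin n → ℤ)} {p : Z → Fin n → ℂˣ}
    {χ : (Fin n → ℤ) → R} (hχ : ∀ a z, (χ a : Z → ℂ) z = mon (p z) a) (f : {x // x ∈ A} → R)
    (hf : ∀ z, evalL (fun a => (f a : Z → ℂ) z) (p z) = 0) (c : {x // x ∈ A}) :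
    ∑ a, f a * χ (a - c) = 0 := by
  ext z
  have := sum_mul_mon_sub_eq_zero (hf z) c
  simpa [hχ] using this

end Monomials

section Consistency

variable {n k : ℕ}

/-- The incidence variety of systems supported in `A` and their zeros. -/
abbrev IncidenceVariety (A : Fin k → Finset (Fin n → ℤ)) : Type :=
  {w : (∀ i, {x // x ∈ A i} → ℂ) × (Fin n → ℂˣ) // ∀ i, evalL (w.1 i) w.2 = 0}

theorem exists_mem_incidenceVariety (A : Fin k → Finset (Fin n → ℤ)) (a₀ : ∀ i, {x // x ∈ A i})
    (p : Fin n → ℂˣ) (g : ((i : Fin k) × {a // a ≠ a₀ i}) → ℂ) :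
    ∃ w : IncidenceVariety A, w.1.2 = p ∧ ∀ v, w.1.1 v.1 v.2 = g v := by
  classical
  let f : ∀ i, {x // x ∈ A i} → ℂ := fun i a =>
    if h : a = a₀ i then -(∑ b : {a // a ≠ a₀ i}, g ⟨i, b⟩ * (mon p b.1.1 : ℂ)) / (mon p (a₀ i) : ℂ)
    else g ⟨i, ⟨a, h⟩⟩
  have hf : ∀ i (b : {a // a ≠ a₀ i}), f i b = g ⟨i, b⟩ := fun i b => dif_neg b.2
  refine ⟨⟨(f, p), fun i => ?_⟩, rfl, fun v => hf v.1 v.2⟩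
  change ∑ a, f i a * _ = 0
  rw [Fintype.sum_eq_add_sum_subtype_ne _ (a₀ i)]
  simp only [hf]
  have : f i (a₀ i) = _ := dif_pos rfl
  rw [this, div_mul_cancel₀ _ (Units.ne_zero _), neg_add_cancel]

theorem eq_zero_of_vanishing_on_incidenceVariety (A : Fin k → Finset (Fin n → ℤ))
    (a₀ : ∀ i, {x // x ∈ A i}) (G : MvPolynomial (Fin n ⊕ ((i : Fin k) × {a // a ≠ a₀ i})) ℂ)
    (hG : ∀ w : IncidenceVariety A,
      MvPolynomial.eval (Sum.elim (fun j => (w.1.2 j : ℂ)) fun v => w.1.1 v.1 v.2) G = 0) :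
    G = 0 := by
  refine MvPolynomial.funext_set (fun _ => {0}ᶜ) (fun _ => (Set.finite_singleton 0).infinite_compl)
    fun u hu => ?_
  have hu0 : ∀ v, u v ≠ 0 := fun v => hu v (Set.mem_univ v)
  obtain ⟨w, hwp, hwg⟩ := exists_mem_incidenceVariety A a₀
    (fun j => Units.mk0 (u (Sum.inl j)) (hu0 _)) fun v => u (Sum.inr v)
  have h1 := hG w
  have h2 : (Sum.elim (fun j => (w.1.2 j : ℂ)) fun v => w.1.1 v.1 v.2) = u := by
    ext (j | v)
    · simp [hwp]
    · simp [hwg]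
  rw [h2] at h1
  rw [h1, map_zero]

theorem card_sum_sigma_ne_add (A : Fin k → Finset (Fin n → ℤ)) (a₀ : ∀ i, {x // x ∈ A i}) :
    Fintype.card (Fin n ⊕ ((i : Fin k) × {a // a ≠ a₀ i})) + k = n + ∑ i, (A i).card := by
  have h1 : ∀ i, Fintype.card {a // a ≠ a₀ i} + 1 = (A i).card := by
    intro i
    have := Fintype.card_subtype_compl (fun a => a = a₀ i)
    have h2 : 0 < (A i).card := Finset.card_pos.2 ⟨_, (a₀ i).2⟩
    simp at this ⊢
    omega
  have h3 := Finset.sum_congr (rfl : (Finset.univ : Finset (Fin k)) = _) fun i _ => h1 i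
  rw [Finset.sum_add_distrib] at h3
  simp only [Fintype.card_sum, Fintype.card_fin, Fintype.card_sigma]
  simp at h3
  simp
  omega

end Consistency

section GenericSystem

variable {n k : ℕ}

theorem AlgHom.mem_of_adjoin {B E : Type*} [CommRing B] [Algebra ℂ B] [Field E] [Algebra ℂ E]
    {S : Set B} (φ : Algebra.adjoin ℂ S →ₐ[ℂ] E) {M : IntermediateField ℂ E}
    (h : ∀ s (hs : s ∈ S), φ ⟨s, Algebra.subset_adjoin hs⟩ ∈ M) (r : Algebra.adjoin ℂ S) :
    φ r ∈ M := by
  obtain ⟨r, hr⟩ := r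
  induction hr using Algebra.adjoin_induction with
  | mem x hx => exact h x hx
  | algebraMap c =>
    have : φ ⟨algebraMap ℂ B c, _⟩ = algebraMap ℂ E c := φ.commutes c
    rw [this]
    exact M.algebraMap_mem c
  | add x y hx hy hx' hy' =>
    have : φ ⟨x + y, _⟩ = φ ⟨x, hx⟩ + φ ⟨y, hy⟩ := map_add φ ⟨x, hx⟩ ⟨y, hy⟩
    rw [this]
    exact add_mem hx' hy'
  | mul x y hx hy hx' hy' =>
    have : φ ⟨x * y, _⟩ = φ ⟨x, hx⟩ * φ ⟨y, hy⟩ := map_mul φ ⟨x, hx⟩ ⟨y, hy⟩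
    rw [this]
    exact mul_mem hx' hy'

theorem mon_single (p : Fin n → ℂˣ) (j : Fin n) (m : ℤ) : mon p (Pi.single j m) = p j ^ m := by
  rw [mon, Finset.prod_eq_single j]
  · simp
  · intro i _ hi
    simp [hi]
  · simp

theorem exists_generic_zero (A : Fin k → Finset (Fin n → ℤ)) (a₀ : ∀ i, {x // x ∈ A i}) :
    ∃ (E : Type) (_ : Field E) (_ : Algebra ℂ E) (P : (Fin n → ℤ) → E)
      (f : ∀ i, {x // x ∈ A i} → E), Algebra.EssFiniteType ℂ E ∧
      P 0 = 1 ∧ (∀ a b, P (a + b) = P a * P b) ∧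
      (∀ i (c : {x // x ∈ A i}), ∑ a, f i a * P (a - c) = 0) ∧
      (∀ M : IntermediateField ℂ E, (∀ a, P a ∈ M) → (∀ i a, f i a ∈ M) → M = ⊤) ∧
      (∃ x : Fin n ⊕ ((i : Fin k) × {a // a ≠ a₀ i}) → E, AlgebraicIndependent ℂ x) ∧
      ∀ G : MvPolynomial ((i : Fin k) × {x // x ∈ A i}) ℂ,
        (∀ w : IncidenceVariety A, MvPolynomial.eval (fun v => w.1.1 v.1 v.2) G = 0) →
        MvPolynomial.aeval (fun v => f v.1 v.2) G = 0 := by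
  let cf : ((i : Fin k) × {x // x ∈ A i}) → IncidenceVariety A → ℂ := fun v w => w.1.1 v.1 v.2
  let cp : Fin n → IncidenceVariety A → ℂ := fun j w => w.1.2 j
  let cq : Fin n → IncidenceVariety A → ℂ := fun j w => (w.1.2 j : ℂ)⁻¹
  let S := Set.range cf ∪ (Set.range cp ∪ Set.range cq)
  let R := Algebra.adjoin ℂ S
  have hR : R.FG := Subalgebra.fg_def.2
    ⟨S, (Set.finite_range _).union ((Set.finite_range _).union (Set.finite_range _)), rfl⟩
  have hcf : ∀ v, cf v ∈ R := fun v => Algebra.subset_adjoin (Or.inl ⟨v, rfl⟩)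
  have hcp : ∀ j, cp j ∈ R := fun j => Algebra.subset_adjoin (Or.inr (Or.inl ⟨j, rfl⟩))
  have hcq : ∀ j, cq j ∈ R := fun j => Algebra.subset_adjoin (Or.inr (Or.inr ⟨j, rfl⟩))
  obtain ⟨χ, hχ, hχ0, hχadd⟩ := exists_mon_mem (R := R) (fun w => w.1.2) hcp hcq
  let y : Fin n ⊕ ((i : Fin k) × {a // a ≠ a₀ i}) → R :=
    Sum.elim (fun j => ⟨cp j, hcp j⟩) fun v => ⟨cf ⟨v.1, v.2⟩, hcf _⟩
  have hy : ∀ w : IncidenceVariety A, (Sum.elim (fun j => (w.1.2 j : ℂ)) fun v => w.1.1 v.1 v.2) =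
      fun i => (y i : IncidenceVariety A → ℂ) w := fun w => by
    ext (j | v) <;> rfl
  obtain ⟨E, _, _, φ, hE, hφ, hind⟩ := exists_field_algebraicIndependent hR y fun G hG =>
    eq_zero_of_vanishing_on_incidenceVariety A a₀ G fun w => by
      rw [hy]
      exact hG w
  refine ⟨E, inferInstance, inferInstance, fun a => φ (χ a), fun i a => φ ⟨cf ⟨i, a⟩, hcf _⟩, hE,
    by simp [hχ0], fun a b => by simp [hχadd], fun i c => ?_,
    fun M hPM hfM => hφ M fun r => φ.mem_of_adjoin ?_ r, ⟨_, hind⟩, fun G hG => ?_⟩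
  · have := congrArg φ (sum_mul_mon_mem_eq_zero hχ (fun a => ⟨cf ⟨i, a⟩, hcf _⟩)
      (fun w => w.2 i) c)
    simpa using this
  · rintro s (⟨v, rfl⟩ | ⟨j, rfl⟩ | ⟨j, rfl⟩)
    · exact hfM v.1 v.2
    · convert! hPM (Pi.single j 1)
      ext w
      simp [hχ, mon_single, cp]
    · convert! hPM (Pi.single j (-1))
      ext w
      simp [hχ, mon_single, cq]
  · have h1 : MvPolynomial.aeval (fun v => (⟨cf v, hcf v⟩ : R)) G = 0 := by
      ext w
      let ψ : R →ₐ[ℂ] ℂ := (Pi.evalAlgHom ℂ (fun _ => ℂ) w).comp R.val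
      change ψ _ = 0
      rw [MvPolynomial.comp_aeval_apply]
      exact hG w
    have h2 := congrArg φ h1
    rwa [MvPolynomial.comp_aeval_apply, map_zero] at h2

theorem exists_vanishing_of_two_zeros (A : Fin k → Finset (Fin n → ℤ))
    (hA : ∀ i, (A i).Nonempty)
    (hess : ∀ J : Finset (Fin k), J ⊂ Finset.univ →
      spanRank (diffs A Finset.univ) + J.card < spanRank (diffs A J) + k)
    {T : Finset ((i : Fin k) × {x // x ∈ A i})}
    (hT : ∑ i, (A i).card + spanRank (diffs A Finset.univ) ≤ T.card + k)
    {d : Fin n → ℤ} (hd : d ∈ diffs A Finset.univ) :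
    ∃ G : MvPolynomial T ℂ, G ≠ 0 ∧ ∀ (f : ∀ i, {x // x ∈ A i} → ℂ) (p q : Fin n → ℂˣ),
      (∀ i, evalL (f i) p = 0) → (∀ i, evalL (f i) q = 0) → mon p d ≠ mon q d →
      MvPolynomial.eval (fun t : T => f t.1.1 t.1.2) G = 0 := by
  by_contra! hcon
  let Z : Type := {w : (∀ i, {x // x ∈ A i} → ℂ) × (Fin n → ℂˣ) × (Fin n → ℂˣ) //
    (∀ i, evalL (w.1 i) w.2.1 = 0) ∧ (∀ i, evalL (w.1 i) w.2.2 = 0) ∧ mon w.2.1 d ≠ mon w.2.2 d}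
  let cf : ((i : Fin k) × {x // x ∈ A i}) → Z → ℂ := fun v w => w.1.1 v.1 v.2
  let cp : Fin n → Z → ℂ := fun j w => w.1.2.1 j
  let cp' : Fin n → Z → ℂ := fun j w => (w.1.2.1 j : ℂ)⁻¹
  let cq : Fin n → Z → ℂ := fun j w => w.1.2.2 j
  let cq' : Fin n → Z → ℂ := fun j w => (w.1.2.2 j : ℂ)⁻¹
  let cd : Z → ℂ := fun w => ((mon w.1.2.1 d : ℂ) - mon w.1.2.2 d)⁻¹
  let S := Set.range cf ∪ (Set.range cp ∪ Set.range cp') ∪ (Set.range cq ∪ Set.range cq') ∪ {cd}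
  let R := Algebra.adjoin ℂ S
  have hR : R.FG := Subalgebra.fg_def.2
    ⟨S, (((Set.finite_range _).union ((Set.finite_range _).union (Set.finite_range _))).union
      ((Set.finite_range _).union (Set.finite_range _))).union (Set.finite_singleton _), rfl⟩
  have hcf : ∀ v, cf v ∈ R := fun v => Algebra.subset_adjoin (by simp [S])
  have hcd : cd ∈ R := Algebra.subset_adjoin (by simp [S])
  obtain ⟨χ, hχ, hχ0, hχadd⟩ := exists_mon_mem (R := R) (fun w => w.1.2.1)
    (fun j => Algebra.subset_adjoin (Or.inl (Or.inl (Or.inr (Or.inl ⟨j, rfl⟩)))))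
    fun j => Algebra.subset_adjoin (Or.inl (Or.inl (Or.inr (Or.inr ⟨j, rfl⟩))))
  obtain ⟨η, hη, hη0, hηadd⟩ := exists_mon_mem (R := R) (fun w => w.1.2.2)
    (fun j => Algebra.subset_adjoin (Or.inl (Or.inr (Or.inl ⟨j, rfl⟩))))
    fun j => Algebra.subset_adjoin (Or.inl (Or.inr (Or.inr ⟨j, rfl⟩)))
  obtain ⟨E, _, _, φ, -, -, hind⟩ := exists_field_algebraicIndependent hR
    (fun t : T => ⟨cf t, hcf t⟩) (fun G hG => by
      by_contra hG0
      obtain ⟨f, p, q, hp, hq, hpq, hne⟩ := hcon G hG0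
      exact hne (hG ⟨(f, p, q), hp, hq, hpq⟩))
  have hunit : (χ d - η d) * ⟨cd, hcd⟩ = 1 := by
    ext w
    have h1 : (mon w.1.2.1 d : ℂ) - mon w.1.2.2 d ≠ 0 :=
      sub_ne_zero.2 fun h => w.2.2.2 (Units.ext h)
    simp [hχ, hη, cd, h1]
  obtain ⟨Y, hYcard, hY⟩ := exists_small_generating_finset_of_two_zeros (K := ℂ) A hA hess
    (P := fun a => φ (χ a)) (Q := fun a => φ (η a))
    (by rw [hχ0, map_one]) (fun a b => by rw [hχadd, map_mul])
    (by rw [hη0, map_one]) (fun a b => by rw [hηadd, map_mul])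
    (fun i a => φ ⟨cf ⟨i, a⟩, hcf _⟩)
    (fun i c => by
      have := congrArg φ (sum_mul_mon_mem_eq_zero hχ (fun a => ⟨cf ⟨i, a⟩, hcf _⟩)
        (fun w => w.2.1 i) c)
      simpa using this)
    (fun i c => by
      have := congrArg φ (sum_mul_mon_mem_eq_zero hη (fun a => ⟨cf ⟨i, a⟩, hcf _⟩)
        (fun w => w.2.2.1 i) c)
      simpa using this)
    ⟨d, hd, fun h => by
      have h1 := congrArg φ hunit
      rw [map_mul, map_sub, sub_eq_zero.2 h, zero_mul, map_one] at h1
      exact zero_ne_one h1⟩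
  have h1 := hind.card_le_of_mem_relAlgClosure Y fun t => hY t.1.1 t.1.2
  rw [Fintype.card_coe] at h1
  omega

theorem finrank_colSpan_realize (A : Fin k → Finset (Fin n → ℤ)) (J : Finset (Fin k)) :
    Module.finrank ℝ (colSpan (fun i => realize (A i)) (J : Set (Fin k))) =
      spanRank (diffs A J) := by
  have h : {v : Fin n → ℝ | ∃ i ∈ (J : Set (Fin k)), ∃ a ∈ realize (A i), ∃ b ∈ realize (A i),
      v = a - b} = realVec '' diffs A J := by
    ext v
    constructor
    · rintro ⟨i, hi, _, ⟨a, ha, rfl⟩, _, ⟨b, hb, rfl⟩, rfl⟩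
      refine ⟨a - b, ⟨i, hi, a, ha, b, hb, rfl⟩, ?_⟩
      ext j
      simp [realVec]
    · rintro ⟨_, ⟨i, hi, a, ha, b, hb, rfl⟩, rfl⟩
      refine ⟨i, hi, _, ⟨a, ha, rfl⟩, _, ⟨b, hb, rfl⟩, ?_⟩
      ext j
      simp [realVec]
  rw [colSpan, h, spanRank]

end GenericSystem

/-- If `A = (A_1, …, A_k)` is an essential collection with negative defect,
then for a generic consistent system (a system in `X_A` outside the zero set of a polynomial
`F` not vanishing identically on `X_A`) the zero set `Y_f` is nonempty and is a single coset
of `ker(G(A))`: for every `x₀ ∈ Y_f`, `Y_f = {x₀·t : t ∈ ker(G(A))}`. -/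
theorem generic_consistent_single_coset {n k : ℕ} (hn : 1 ≤ n)
    (A : Fin k → Finset (Fin n → ℤ)) (hA : ∀ i, (A i).Nonempty)
    (hneg : colDefect (fun i => realize (A i)) Finset.univ < 0)
    (hfull : colMinDefectOn (fun i => realize (A i)) Finset.univ =
      colDefect (fun i => realize (A i)) Finset.univ)
    (hess : ∀ J : Finset (Fin k), J ⊂ Finset.univ →
      colMinDefectOn (fun i => realize (A i)) Finset.univ <
        colDefect (fun i => realize (A i)) J) :
    ∃ F : MvPolynomial ((i : Fin k) × {x // x ∈ A i}) ℂ,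
      (∃ f : ∀ i, {x // x ∈ A i} → ℂ, (∃ p : Fin n → ℂˣ, ∀ i, evalL (f i) p = 0) ∧
        MvPolynomial.eval (fun v => f v.1 v.2) F ≠ 0) ∧
      ∀ f : ∀ i, {x // x ∈ A i} → ℂ,
        (∃ p : Fin n → ℂˣ, ∀ i, evalL (f i) p = 0) →
        MvPolynomial.eval (fun v => f v.1 v.2) F ≠ 0 →
        ∀ x₀ : Fin n → ℂˣ, (∀ i, evalL (f i) x₀ = 0) →
          ∀ q : Fin n → ℂˣ,
            ((∀ i, evalL (f i) q = 0) ↔ ∃ t : Fin n → ℂˣ, inKer A t ∧ q = x₀ * t) := by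
  classical
  have hess' : ∀ J : Finset (Fin k), J ⊂ Finset.univ →
      spanRank (diffs A Finset.univ) + J.card < spanRank (diffs A J) + k := by
    intro J hJ
    have h := hess J hJ
    rw [hfull, colDefect, colDefect, finrank_colSpan_realize, finrank_colSpan_realize,
      Finset.card_univ, Fintype.card_fin] at h
    omega
  let a₀ : ∀ i, {x // x ∈ A i} := fun i => ⟨(hA i).choose, (hA i).choose_spec⟩
  obtain ⟨E, _, _, P, f, _, hP0, hP, hf, hgen, ⟨x, hx⟩, hvan⟩ := exists_generic_zero A a₀
  obtain ⟨T, hTind, hT⟩ := exists_algebraicIndependent_finset (K := ℂ)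
    fun v : (i : Fin k) × {x // x ∈ A i} => f v.1 v.2
  have hTcard := le_card_add_of_mem_relAlgClosure A hA hess' hP0 hP f hf hgen hx
    (card_sum_sigma_ne_add A a₀) T fun i a => hT ⟨i, a⟩
  have hG : ∀ v : (i : Fin k) × ({x // x ∈ A i} × {x // x ∈ A i}),
      (v.2.1 - v.2.2 : Fin n → ℤ) ∈ diffs A Finset.univ := fun v =>
    ⟨v.1, Finset.mem_univ _, _, v.2.1.2, _, v.2.2.2, rfl⟩
  choose G hG0 hG using fun v => exists_vanishing_of_two_zeros A hA hess' hTcard (hG v)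
  have heval : ∀ f : ∀ i, {x // x ∈ A i} → ℂ,
      MvPolynomial.eval (fun v => f v.1 v.2) (MvPolynomial.rename Subtype.val (∏ v, G v)) =
        ∏ v, MvPolynomial.eval (fun t : T => f t.1.1 t.1.2) (G v) := fun f => by
    rw [MvPolynomial.eval_rename, map_prod]
    rfl
  refine ⟨MvPolynomial.rename Subtype.val (∏ v, G v), ?_, ?_⟩
  · by_contra! hcon
    have h1 := hvan _ fun w => hcon w.1.1 ⟨w.1.2, w.2⟩
    rw [MvPolynomial.aeval_rename] at h1
    exact Finset.prod_ne_zero_iff.2 (fun v _ => hG0 v)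
      ((algebraicIndependent_iff.1 hTind) _ h1)
  · intro g _ hg x₀ hx₀ q
    constructor
    · intro hq
      refine ⟨x₀⁻¹ * q, fun i a ha b hb => ?_, by rw [mul_inv_cancel_left]⟩
      rw [mon_mul, mon_inv, inv_mul_eq_one]
      by_contra hne
      rw [heval] at hg
      exact Finset.prod_ne_zero_iff.1 hg ⟨i, ⟨a, ha⟩, ⟨b, hb⟩⟩ (Finset.mem_univ _)
        (hG _ g x₀ q hx₀ hq hne)
    · rintro ⟨t, ht, rfl⟩ i
      exact evalL_mul_of_inKer hA ht i (g i) (hx₀ i)
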